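/- Let T be a bounded linear operator on a nontrivial complex Hilbert space H and let s ≥ 1. Then w^{2s}(T) ≤ (1/2) ‖ |T|^{2s} + |T*|^{2s} ‖ − (1/2) · inf_{‖x‖=1} ( ⟨|T|^{s}x, x⟩ − ⟨|T*|^{s}x, x⟩ )². -/

import Mathlib

open scoped InnerProductSpace NNReal

variable {H : Type*} [NormedAddCommGroup H] [InnerProductSpace ℂ H] [CompleteSpace H]

/-- The numerical radius `w(T) = sup { |⟨Tx, x⟩| : ‖x‖ = 1 }`. -/
noncomputable def numRadius (T : H →L[ℂ] H) : ℝ :=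
  ⨆ x : {x : H // ‖x‖ = 1}, ‖⟪T x.1, x.1⟫_ℂ‖

/-- The absolute value `|T| = (T*T)^(1/2)`. -/
noncomputable def opAbs (T : H →L[ℂ] H) : H →L[ℂ] H :=
  CFC.sqrt (star T * T)

/-- The real power `|T|^s` of the absolute value, via the continuous functional calculus. -/
noncomputable def opAbsPow (T : H →L[ℂ] H) (s : ℝ) : H →L[ℂ] H :=
  CFC.rpow (opAbs T) s

/-- If `t` intertwines the squares of two nonnegative elements, it intertwines the elements. -/
lemma SemiconjBy.of_mul_self_of_nonneg {𝓐 : Type*} [CStarAlgebra 𝓐] [PartialOrder 𝓐]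
    [StarOrderedRing 𝓐] {t a b : 𝓐} (ha : 0 ≤ a) (hb : 0 ≤ b)
    (h : SemiconjBy t (a * a) (b * b)) : SemiconjBy t a b := by
  have hsa : star a = a := (IsSelfAdjoint.of_nonneg ha).star_eq
  have hsb : star b = b := (IsSelfAdjoint.of_nonneg hb).star_eq
  have h1 : t * (a * a) = b * b * t := h
  obtain ⟨d, hd⟩ : ∃ d, d = t * a - b * t := ⟨_, rfl⟩
  have h2 : b * d = -(d * a) := by
    have : b * d + d * a = t * (a * a) - b * b * t := by rw [hd]; noncomm_ring
    rw [h1, sub_self] at this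
    exact eq_neg_of_add_eq_zero_left this
  have h3 : a * star d = -(star d * b) := by
    have := congrArg star h2
    simp only [star_mul, star_neg, hsa, hsb] at this
    rw [this, neg_neg]
  have h4 : b * (d * star d) = -(d * a * star d) := by rw [← mul_assoc, h2, neg_mul]
  have hcomm : Commute b (d * star d) := by
    change b * (d * star d) = d * star d * b
    rw [h4, mul_assoc, h3, mul_neg, neg_neg, mul_assoc]
  have h5 : 0 ≤ b * (d * star d) := hcomm.mul_nonneg hb (mul_star_self_nonneg d)
  have h6 : 0 ≤ d * a * star d := star_right_conjugate_nonneg ha d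
  have h7 : b * (d * star d) = 0 := by
    refine le_antisymm ?_ h5
    rw [h4]
    exact neg_nonpos.mpr h6
  have h8 : b * d = 0 := by
    rw [← CStarRing.mul_star_self_eq_zero_iff, star_mul, hsb,
      show b * d * (star d * b) = b * (d * star d) * b by noncomm_ring, h7, zero_mul]
  have h9 : d * a = 0 := by rw [h8] at h2; exact neg_eq_zero.mp h2.symm
  have h10 : star d * d = a * star t * d := by
    nth_rewrite 1 [hd]
    rw [star_sub, star_mul, star_mul, hsa, hsb, sub_mul, mul_assoc (star t), h8, mul_zero,
      sub_zero]
  have h11 : star d * d = 0 := by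
    rw [← CStarRing.star_mul_self_eq_zero_iff, star_mul, star_star,
      show star d * d * (star d * d) = star d * (d * (star d * d)) by noncomm_ring]
    rw [h10, show d * (a * star t * d) = d * a * (star t * d) by noncomm_ring, h9, zero_mul,
      mul_zero]
  have h12 : d = 0 := CStarRing.star_mul_self_eq_zero_iff d |>.mp h11
  exact sub_eq_zero.mp (hd ▸ h12)

/-- The Cauchy–Schwarz inequality for the form `⟪B u, v⟫` of a nonnegative operator. -/
lemma norm_inner_sq_le_of_nonneg {B : H →L[ℂ] H} (hB : 0 ≤ B) (u v : H) :
    ‖⟪B u, v⟫_ℂ‖ ^ 2 ≤ (⟪B u, u⟫_ℂ).re * (⟪B v, v⟫_ℂ).re := by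
  have hR : (CFC.sqrt B).IsPositive :=
    (ContinuousLinearMap.nonneg_iff_isPositive _).mp (CFC.sqrt_nonneg B)
  have key (x y : H) : ⟪B x, y⟫_ℂ = ⟪CFC.sqrt B x, CFC.sqrt B y⟫_ℂ := by
    rw [← hR.inner_left_eq_inner_right, ← mul_apply_eq_comp,
      CFC.sqrt_mul_sqrt_self B hB]
  have := inner_mul_inner_self_le (𝕜 := ℂ) (CFC.sqrt B u) (CFC.sqrt B v)
  rw [norm_inner_symm (CFC.sqrt B v), ← sq] at this
  simpa only [key, RCLike.re_to_complex] using this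

lemma opAbs_nonneg (T : H →L[ℂ] H) : 0 ≤ opAbs T := CFC.sqrt_nonneg _

lemma opAbsPow_nonneg (T : H →L[ℂ] H) (s : ℝ) : 0 ≤ opAbsPow T s :=
  CFC.rpow_nonneg (a := opAbs T) (y := s)

lemma opAbs_mul_self (T : H →L[ℂ] H) : opAbs T * opAbs T = star T * T :=
  CFC.sqrt_mul_sqrt_self _ (star_mul_self_nonneg T)

lemma semiconjBy_opAbs (T : H →L[ℂ] H) : SemiconjBy T (opAbs T) (opAbs (star T)) := by
  refine .of_mul_self_of_nonneg (opAbs_nonneg _) (opAbs_nonneg _) ?_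
  rw [opAbs_mul_self, opAbs_mul_self, star_star]
  exact (mul_assoc _ _ _).symm

/-- The mixed Schwarz inequality. -/
lemma norm_inner_sq_le_opAbs (T : H →L[ℂ] H) (x y : H) :
    ‖⟪T x, y⟫_ℂ‖ ^ 2 ≤ (⟪opAbs T x, x⟫_ℂ).re * (⟪opAbs (star T) y, y⟫_ℂ).re := by
  have hA := (ContinuousLinearMap.nonneg_iff_isPositive _).mp (opAbs_nonneg T)
  let K : Submodule ℂ H := (opAbs T).range.topologicalClosure
  have hK : ∀ z ∈ K,
      ‖⟪T z, y⟫_ℂ‖ ^ 2 ≤ (⟪opAbs T z, z⟫_ℂ).re * (⟪opAbs (star T) y, y⟫_ℂ).re := by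
    refine closure_minimal (t := {z : H | ‖⟪T z, y⟫_ℂ‖ ^ 2 ≤
      (⟪opAbs T z, z⟫_ℂ).re * (⟪opAbs (star T) y, y⟫_ℂ).re}) ?_
      (isClosed_le (by fun_prop) (by fun_prop))
    rintro - ⟨z, rfl⟩
    have h1 : T (opAbs T z) = opAbs (star T) (T z) :=
      DFunLike.congr_fun (semiconjBy_opAbs T).eq z
    have h2 : ⟪opAbs (star T) (T z), T z⟫_ℂ = ⟪opAbs T (opAbs T z), opAbs T z⟫_ℂ := by
      rw [← h1, ← ContinuousLinearMap.adjoint_inner_left, ← ContinuousLinearMap.star_eq_adjoint,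
        ← mul_apply_eq_comp, ← opAbs_mul_self, mul_apply_eq_comp,
        hA.inner_left_eq_inner_right]
    have := norm_inner_sq_le_of_nonneg (opAbs_nonneg (star T)) (T z) y
    rw [h2, ← h1] at this
    exact this
  have : CompleteSpace K := (Submodule.isClosed_topologicalClosure _).completeSpace_coe
  obtain ⟨p, hp, w, hw, rfl⟩ := K.exists_add_mem_mem_orthogonal x
  have hw' : ∀ z, ⟪opAbs T z, w⟫_ℂ = 0 := fun z ↦
    hw _ (Submodule.le_topologicalClosure _ ⟨z, rfl⟩)
  have hAw : opAbs T w = 0 := by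
    rw [← inner_self_eq_zero (𝕜 := ℂ), ← hA.inner_left_eq_inner_right]
    exact hw' _
  have hTw : T w = 0 := by
    rw [← inner_self_eq_zero (𝕜 := ℂ), ← ContinuousLinearMap.adjoint_inner_left,
      ← ContinuousLinearMap.star_eq_adjoint, ← mul_apply_eq_comp, ← opAbs_mul_self,
      mul_apply_eq_comp]
    exact hw' _
  simpa [hAw, hTw, inner_add_right, hw'] using hK p hp

lemma rpow_tangent_le {t u s : ℝ} (ht : 0 ≤ t) (hu : 0 < u) (hs : 1 ≤ s) :
    u ^ s - s * u ^ s + s * u ^ (s - 1) * t ≤ t ^ s := by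
  have h := one_add_mul_self_le_rpow_one_add (s := t / u - 1)
    (by linarith [div_nonneg ht hu.le]) hs
  have hus : 0 < u ^ s := Real.rpow_pos_of_pos hu s
  rw [add_sub_cancel, Real.div_rpow ht hu.le, le_div_iff₀ hus] at h
  refine le_trans (le_of_eq ?_) h
  rw [Real.rpow_sub_one hu.ne']
  field_simp
  ring

/-- The Hölder–McCarthy inequality. -/
lemma inner_rpow_le_inner_opAbsPow (T : H →L[ℂ] H) {s : ℝ} (hs : 1 ≤ s) {x : H} (hx : ‖x‖ = 1) :
    (⟪opAbs T x, x⟫_ℂ).re ^ s ≤ (⟪opAbsPow T s x, x⟫_ℂ).re := by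
  have hA := opAbs_nonneg T
  have hA' := (ContinuousLinearMap.nonneg_iff_isPositive _).mp hA
  have hP := opAbsPow_nonneg T s
  have hs0 : 0 < s := by linarith
  have hu0 : 0 ≤ (⟪opAbs T x, x⟫_ℂ).re := hA'.re_inner_nonneg_left x
  obtain hu | hu := hu0.eq_or_lt
  · rw [← hu, Real.zero_rpow hs0.ne']
    exact ((ContinuousLinearMap.nonneg_iff_isPositive _).mp hP).re_inner_nonneg_left x
  set u := (⟪opAbs T x, x⟫_ℂ).re with hu_def
  have hle : algebraMap ℝ (H →L[ℂ] H) (u ^ s - s * u ^ s) + (s * u ^ (s - 1)) • opAbs T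
      ≤ opAbsPow T s := by
    have h1 : opAbsPow T s = cfc (fun t : ℝ ↦ t ^ s) (opAbs T) := CFC.rpow_eq_cfc_real hA
    have hcont : ContinuousOn (fun t : ℝ ↦ t ^ s) (spectrum ℝ (opAbs T)) :=
      (Real.continuous_rpow_const hs0.le).continuousOn
    rw [h1, ← cfc_const_mul_id (s * u ^ (s - 1)) (opAbs T), ← cfc_const_add _ _ (opAbs T)]
    exact cfc_mono (fun t ht ↦ rpow_tangent_le (spectrum_nonneg_of_nonneg hA ht) hu hs)
  have h2 := (((ContinuousLinearMap.le_def _ _).mp hle).re_inner_nonneg_left x)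
  have h3 : (⟪(algebraMap ℝ (H →L[ℂ] H) (u ^ s - s * u ^ s) +
      (s * u ^ (s - 1)) • opAbs T) x, x⟫_ℂ).re = u ^ s := by
    have : u ^ (s - 1) * u = u ^ s := by
      rw [Real.rpow_sub_one hu.ne', div_mul_cancel₀ _ hu.ne']
    rw [Algebra.algebraMap_eq_smul_one, add_apply, smul_apply, smul_apply, one_apply_eq_self,
      inner_add_left, inner_smul_left_eq_smul, inner_smul_left_eq_smul,
      inner_self_eq_norm_sq_to_K, hx]
    simp only [Complex.add_re, Complex.real_smul, Complex.re_ofReal_mul, ← hu_def]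
    simp
    linear_combination s * this
  rw [sub_apply, inner_sub_left, map_sub] at h2
  simp only [RCLike.re_to_complex] at h2
  linarith

lemma opAbsPow_two_mul (T : H →L[ℂ] H) {s : ℝ} (hs : 0 ≤ s) :
    opAbsPow T (2 * s) = opAbsPow T s * opAbsPow T s := by
  have h := CFC.rpow_rpow_of_exponent_nonneg (opAbs T) s (2 : ℕ) hs (by positivity)
    (opAbs_nonneg T)
  rw [CFC.rpow_natCast _ _ CFC.rpow_nonneg, sq] at h
  rw [mul_comm]
  exact_mod_cast h.symm

lemma sq_inner_opAbsPow_le (T : H →L[ℂ] H) {s : ℝ} (hs : 0 ≤ s) {x : H} (hx : ‖x‖ = 1) :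
    (⟪opAbsPow T s x, x⟫_ℂ).re ^ 2 ≤ (⟪opAbsPow T (2 * s) x, x⟫_ℂ).re := by
  have hP : (opAbsPow T s).IsPositive :=
    (ContinuousLinearMap.nonneg_iff_isPositive _).mp (opAbsPow_nonneg T s)
  rw [opAbsPow_two_mul T hs, mul_apply_eq_comp, hP.inner_left_eq_inner_right (opAbsPow T s x),
    inner_self_eq_norm_sq_to_K]
  have h1 : |(⟪opAbsPow T s x, x⟫_ℂ).re| ≤ ‖opAbsPow T s x‖ := by
    refine (Complex.abs_re_le_norm _).trans ?_
    simpa [hx] using norm_inner_le_norm (𝕜 := ℂ) (opAbsPow T s x) x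
  have h2 := sq_le_sq' (neg_le_of_abs_le h1) (le_of_abs_le h1)
  refine h2.trans (le_of_eq ?_)
  norm_cast

lemma norm_inner_rpow_le (T : H →L[ℂ] H) {s : ℝ} (hs : 1 ≤ s) {x : H} (hx : ‖x‖ = 1) :
    ‖⟪T x, x⟫_ℂ‖ ^ (2 * s) ≤
      (⟪opAbsPow T s x, x⟫_ℂ).re * (⟪opAbsPow (star T) s x, x⟫_ℂ).re := by
  have hpos (S : H →L[ℂ] H) : 0 ≤ (⟪opAbs S x, x⟫_ℂ).re :=
    ((ContinuousLinearMap.nonneg_iff_isPositive _).mp (opAbs_nonneg S)).re_inner_nonneg_left x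
  have hs0 : 0 ≤ s := by linarith
  rw [Real.rpow_mul (norm_nonneg _), Real.rpow_two]
  calc (‖⟪T x, x⟫_ℂ‖ ^ 2) ^ s
      ≤ ((⟪opAbs T x, x⟫_ℂ).re * (⟪opAbs (star T) x, x⟫_ℂ).re) ^ s :=
        Real.rpow_le_rpow (by positivity) (norm_inner_sq_le_opAbs T x x) hs0
    _ = (⟪opAbs T x, x⟫_ℂ).re ^ s * (⟪opAbs (star T) x, x⟫_ℂ).re ^ s :=
        Real.mul_rpow (hpos T) (hpos _)
    _ ≤ _ := mul_le_mul (inner_rpow_le_inner_opAbsPow T hs hx)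
        (inner_rpow_le_inner_opAbsPow (star T) hs hx) (Real.rpow_nonneg (hpos _) _)
        ((Real.rpow_nonneg (hpos _) _).trans (inner_rpow_le_inner_opAbsPow T hs hx))

theorem stmt12 [Nontrivial H] (T : H →L[ℂ] H) (s : ℝ) (hs : 1 ≤ s) :
    numRadius T ^ (2 * s) ≤
      (1 / 2 : ℝ) * ‖opAbsPow T (2 * s) + opAbsPow (star T) (2 * s)‖ -
        (1 / 2 : ℝ) *
          ⨅ x : {x : H // ‖x‖ = 1},
            ((⟪(opAbsPow T s) x.1, x.1⟫_ℂ).re -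
              (⟪(opAbsPow (star T) s) x.1, x.1⟫_ℂ).re) ^ 2 := by
  have hs0 : 0 ≤ s := by linarith
  have h2s : 0 < 2 * s := by linarith
  set C := (1 / 2 : ℝ) * ‖opAbsPow T (2 * s) + opAbsPow (star T) (2 * s)‖ -
        (1 / 2 : ℝ) *
          ⨅ x : {x : H // ‖x‖ = 1},
            ((⟪(opAbsPow T s) x.1, x.1⟫_ℂ).re -
              (⟪(opAbsPow (star T) s) x.1, x.1⟫_ℂ).re) ^ 2 with hC
  have key (x : {x : H // ‖x‖ = 1}) : ‖⟪T x.1, x.1⟫_ℂ‖ ^ (2 * s) ≤ C := by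
    have h1 := norm_inner_rpow_le T hs x.2
    have h2 := sq_inner_opAbsPow_le T hs0 x.2
    have h3 := sq_inner_opAbsPow_le (star T) hs0 x.2
    have h4 : (⟪opAbsPow T (2 * s) x.1, x.1⟫_ℂ).re + (⟪opAbsPow (star T) (2 * s) x.1, x.1⟫_ℂ).re
        ≤ ‖opAbsPow T (2 * s) + opAbsPow (star T) (2 * s)‖ := by
      rw [← Complex.add_re, ← inner_add_left, ← add_apply]
      refine (Complex.re_le_norm _).trans ((norm_inner_le_norm _ _).trans ?_)
      simpa [x.2] using (opAbsPow T (2 * s) + opAbsPow (star T) (2 * s)).le_opNorm x.1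
    have h5 := ciInf_le (f := fun x : {x : H // ‖x‖ = 1} ↦
      ((⟪(opAbsPow T s) x.1, x.1⟫_ℂ).re - (⟪(opAbsPow (star T) s) x.1, x.1⟫_ℂ).re) ^ 2)
      ⟨0, by rintro - ⟨y, rfl⟩; exact sq_nonneg _⟩ x
    rw [hC]
    linarith
  obtain ⟨x₀, hx₀⟩ := exists_norm_eq H zero_le_one
  have : Nonempty {x : H // ‖x‖ = 1} := ⟨⟨x₀, hx₀⟩⟩
  have hC0 : 0 ≤ C := (Real.rpow_nonneg (norm_nonneg _) _).trans (key ⟨x₀, hx₀⟩)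
  have hle : numRadius T ≤ C ^ (2 * s)⁻¹ :=
    ciSup_le fun x ↦ (Real.le_rpow_inv_iff_of_pos (norm_nonneg _) hC0 h2s).mpr (key x)
  have h0 : 0 ≤ numRadius T := Real.iSup_nonneg fun _ ↦ norm_nonneg _
  exact (Real.le_rpow_inv_iff_of_pos h0 hC0 h2s).mp hle
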